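/- Let G be a countably infinite discrete amenable group acting continuously on a compact Hausdorff space X, and let {F_n} be any tempered Følner sequence in G. Then the Bowen (dimensional) topological entropy of the whole space is bounded below by the topological entropy: h^B_top(X,{F_n}) ≥ h_top(X,G). -/

import Mathlib

/-!
Bowen (dimensional) topological entropy for actions of countably infinite amenable groups,
and the theorem that it equals the usual topological entropy along any tempered Følner
sequence (Theorem 1.1 of Dou–Zhang).
-/

open Filter Topology Pointwise Set
open scoped ENNReal NNReal

section Defs

variable {G : Type*} [Group G] [DecidableEq G]

/-- `F` is a (left) Følner sequence: each `F n` is nonempty and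
`|F n ∆ gF n| / |F n| → 0` for every `g ∈ G`. -/
def IsFolnerSeq (F : ℕ → Finset G) : Prop :=
  (∀ n, (F n).Nonempty) ∧
    ∀ g : G, Filter.Tendsto
      (fun n => ((symmDiff (F n) ((F n).image (fun h => g * h))).card : ℝ) / ((F n).card : ℝ))
      Filter.atTop (nhds 0)

/-- `F` is tempered: there is `C > 0` with `|⋃_{k<n} (F k)⁻¹ (F n)| ≤ C |F n|` for all `n`. -/
def IsTemperedSeq (F : ℕ → Finset G) : Prop :=
  ∃ C : ℝ, 0 < C ∧ ∀ n : ℕ,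
    ((((Finset.range n).biUnion fun k => (F k)⁻¹ * F n)).card : ℝ) ≤ C * ((F n).card : ℝ)

variable {X : Type*} [TopologicalSpace X] [MulAction G X]

/-- The set `X(U) = ⋂_{g ∈ F} g⁻¹ U_g` associated to a `(𝒰,F)`-name `u`. -/
def nameSet (F : Finset G) (u : G → Set X) : Set X := {x : X | ∀ g ∈ F, g • x ∈ u g}

/-- `𝒰` is a finite open cover of the set `Z`. -/
def IsFiniteOpenCoverOn (𝒰 : Finset (Set X)) (Z : Set X) : Prop :=
  (∀ V ∈ 𝒰, IsOpen V) ∧ Z ⊆ ⋃₀ (𝒰 : Set (Set X))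

/-- `N(⋁_{g ∈ F} g⁻¹ 𝒰)` relative to `Z` : the minimal cardinality of a family of
`(𝒰,F)`-names whose associated sets cover `Z`. -/
noncomputable def covNum (𝒰 : Finset (Set X)) (F : Finset G) (Z : Set X) : ℕ :=
  sInf {k : ℕ | ∃ Λ : Finset (G → Set X), Λ.card = k ∧
    (∀ u ∈ Λ, ∀ g ∈ F, u g ∈ 𝒰) ∧ Z ⊆ ⋃ u ∈ Λ, nameSet F u}

/-- The entropy of the cover `𝒰` along the Følner sequence `Fseq`,
`lim_n (1/|F n|) log N(⋁_{g ∈ F n} g⁻¹𝒰)` (the limit exists by the Ornstein–Weiss lemma,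
so we may express it as a `limsup`). -/
noncomputable def coverEntropyOf (Fseq : ℕ → Finset G) (𝒰 : Finset (Set X)) (Z : Set X) :
    ℝ≥0∞ :=
  Filter.limsup
    (fun n => ENNReal.ofReal (Real.log (covNum 𝒰 (Fseq n) Z) / ((Fseq n).card : ℝ)))
    Filter.atTop

/-- The topological entropy `h_top(X,G) = sup_𝒰 lim_n (1/|F n|) log N(⋁_{g∈F n} g⁻¹𝒰)`,
the supremum over all finite open covers `𝒰` of `X`. -/
noncomputable def topEntropy (X : Type*) [TopologicalSpace X] [MulAction G X]
    (Fseq : ℕ → Finset G) : ℝ≥0∞ :=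
  ⨆ (𝒰 : Finset (Set X)) (_ : IsFiniteOpenCoverOn 𝒰 (Set.univ : Set X)),
    coverEntropyOf Fseq 𝒰 (Set.univ : Set X)

/-- `ℳ(Z,𝒰,N,s,{F n})`: the infimum of `∑_{U ∈ Λ} exp(-s·m(U))` over all collections `Λ`
of `(𝒰, F j)`-names with `j ≥ N` whose associated sets cover `Z`. -/
noncomputable def bowenM (Fseq : ℕ → Finset G) (𝒰 : Finset (Set X)) (Z : Set X)
    (N : ℕ) (s : ℝ) : ℝ≥0∞ :=
  ⨅ (Λ : Set (ℕ × (G → Set X)))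
    (_ : ∀ p ∈ Λ, N ≤ p.1 ∧ ∀ g ∈ Fseq p.1, p.2 g ∈ 𝒰)
    (_ : Z ⊆ ⋃ p ∈ Λ, nameSet (Fseq p.1) p.2),
    ∑' p : Λ, ENNReal.ofReal (Real.exp (-s * ((Fseq p.1.1).card : ℝ)))

/-- `ℳ(Z,𝒰,s,{F n}) = lim_{N→∞} ℳ(Z,𝒰,N,s,{F n})`; the quantity is nondecreasing in `N`,
so the limit is the supremum. -/
noncomputable def bowenMlim (Fseq : ℕ → Finset G) (𝒰 : Finset (Set X)) (Z : Set X)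
    (s : ℝ) : ℝ≥0∞ :=
  ⨆ N : ℕ, bowenM Fseq 𝒰 Z N s

/-- `h^B_top(𝒰,Z,{F n}) = inf {s ≥ 0 : ℳ(Z,𝒰,s,{F n}) = 0}`. -/
noncomputable def bowenEntropyCover (Fseq : ℕ → Finset G) (𝒰 : Finset (Set X)) (Z : Set X) :
    ℝ≥0∞ :=
  ⨅ (s : ℝ≥0) (_ : bowenMlim Fseq 𝒰 Z (s : ℝ) = 0), (s : ℝ≥0∞)

/-- The Bowen (dimensional) topological entropy
`h^B_top(Z,{F n}) = sup_𝒰 h^B_top(𝒰,Z,{F n})` over finite open covers `𝒰` of `X`. -/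
noncomputable def bowenEntropy (Fseq : ℕ → Finset G) (Z : Set X) : ℝ≥0∞ :=
  ⨆ (𝒰 : Finset (Set X)) (_ : IsFiniteOpenCoverOn 𝒰 (Set.univ : Set X)),
    bowenEntropyCover Fseq 𝒰 Z

end Defs

section Covering

variable {G : Type*} [Group G] [DecidableEq G]

theorem mem_mul_singleton_iff {S : Finset G} {g h : G} :
    g ∈ S * {h} ↔ ∃ s ∈ S, s * h = g := by
  simp [Finset.mem_mul]

theorem sum_card_translate_inter_le (S A E : Finset G) :
    ∑ h ∈ A, ((S * {h}) ∩ E).card ≤ S.card * E.card := by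
  have h1 : ∀ h ∈ A, ((S * {h}) ∩ E).card =
      (E.bipartiteAbove (fun (h e : G) => e ∈ S * {h}) h).card := by
    intro h _
    congr 1
    ext e
    simp only [Finset.mem_inter, Finset.bipartiteAbove, Finset.mem_filter]
    tauto
  rw [Finset.sum_congr rfl h1, Finset.sum_card_bipartiteAbove_eq_sum_card_bipartiteBelow,
    mul_comm, ← smul_eq_mul]
  refine Finset.sum_le_card_nsmul _ _ _ fun e _ => ?_
  refine Finset.card_le_card_of_injOn (fun h => e * h⁻¹) ?_ ?_
  · intro h hh
    simp only [Finset.bipartiteBelow, Finset.coe_filter, Set.mem_ofPred_eq,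
      mem_mul_singleton_iff] at hh
    obtain ⟨_, s, hs, rfl⟩ := hh
    simpa using hs
  · intro a _ b _ hab
    simpa using hab

/-- A maximal family of almost disjoint right translates of `S` with centres in `A` covers at
least a fixed proportion of `|A|`. -/
theorem exists_almostDisjoint_translates {ε : ℝ} (hε1 : ε ≤ 1) (S A : Finset G)
    (hS : S.Nonempty) :
    ∃ T ⊆ A, (1 - ε) * (S.card * T.card) ≤ ((S * T).card : ℝ) ∧
      ε * A.card ≤ ((S * T).card : ℝ) := by
  classical
  have hSpos : (0 : ℝ) < S.card := by exact_mod_cast hS.card_pos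
  obtain ⟨T, hT, hmax⟩ := Finset.exists_max_image
    (A.powerset.filter fun T => (1 - ε) * (S.card * T.card) ≤ ((S * T).card : ℝ))
    Finset.card ⟨∅, by simp⟩
  simp only [Finset.mem_filter, Finset.mem_powerset] at hT hmax
  refine ⟨T, hT.1, hT.2, ?_⟩
  have key : ∀ h ∈ A, ε * S.card ≤ (((S * {h}) ∩ (S * T)).card : ℝ) := by
    intro h hA
    by_cases hh : h ∈ T
    · have : (S * {h}) ∩ (S * T) = S * {h} :=
        Finset.inter_eq_left.2 (Finset.mul_subset_mul_left (by simpa using hh))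
      rw [this, Finset.card_mul_singleton]
      nlinarith
    · by_contra! hlt
      have hu : S * insert h T = (S * {h}) ∪ (S * T) := by
        rw [Finset.insert_eq, Finset.mul_union]
      have hc : ((S * insert h T).card : ℝ) + ((S * {h}) ∩ (S * T)).card
          = S.card + (S * T).card := by
        rw [hu]
        have := Finset.card_union_add_card_inter (S * {h}) (S * T)
        rw [Finset.card_mul_singleton] at this
        exact_mod_cast this
      have hci : ((insert h T).card : ℝ) = T.card + 1 := by
        rw [Finset.card_insert_of_notMem hh]; push_cast; ring
      have := hmax (insert h T) ⟨Finset.insert_subset hA hT.1, by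
        rw [hci]; nlinarith [hT.2]⟩
      rw [Finset.card_insert_of_notMem hh] at this
      omega
  have hsum : (A.card : ℝ) * (ε * S.card) ≤ S.card * (S * T).card := by
    calc (A.card : ℝ) * (ε * S.card) = ∑ h ∈ A, ε * S.card := by simp
      _ ≤ ∑ h ∈ A, (((S * {h}) ∩ (S * T)).card : ℝ) := Finset.sum_le_sum key
      _ ≤ _ := by exact_mod_cast sum_card_translate_inter_le S A (S * T)
  have : (S.card : ℝ) * (ε * A.card) ≤ S.card * (S * T).card := by linarith
  exact le_of_mul_le_mul_left this hSpos

/-- Vitali-type covering lemma for tempered sequences. -/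
theorem exists_almostDisjoint_tiles {F : ℕ → Finset G} (hne : ∀ n, (F n).Nonempty) {C ε : ℝ}
    (hC : 0 < C)
    (hF : ∀ n, ((((Finset.range n).biUnion fun k => (F k)⁻¹ * F n)).card : ℝ) ≤
      C * ((F n).card : ℝ))
    (hε : 0 < ε) (hε1 : ε ≤ 1 / 2) (j : G → ℕ) (e : ℕ) :
    ∀ A : Finset G, (∀ h ∈ A, j h < e) → ∃ T ⊆ A,
      (1 - ε) * (∑ h ∈ T, ((F (j h)).card : ℝ)) ≤
        ((T.biUnion fun h => F (j h) * {h}).card : ℝ) ∧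
      (A.card : ℝ) ≤ (1 / ε + 2 * C) * ((T.biUnion fun h => F (j h) * {h}).card : ℝ) := by
  classical
  induction e with
  | zero =>
    intro A hA
    have : A = ∅ := Finset.eq_empty_of_forall_notMem fun h hh => by simpa using hA h hh
    subst this
    exact ⟨∅, by simp⟩
  | succ e ih =>
    intro A hA
    obtain ⟨T₁, hT₁, hd₁, hc₁⟩ := exists_almostDisjoint_translates (ε := ε) (by linarith) (F e)
      (A.filter fun h => j h = e) (hne e)
    set E := F e * T₁ with hE
    obtain ⟨T₂, hT₂, hd₂, hc₂⟩ := ih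
      ((A.filter fun h => j h < e).filter fun h => Disjoint (F (j h) * {h}) E) (by
        intro h hh
        simp only [Finset.mem_filter] at hh
        exact hh.1.2)
    set U := T₂.biUnion fun h => F (j h) * {h} with hU
    have hj₁ : ∀ h ∈ T₁, h ∈ A ∧ j h = e := fun h hh => by simpa using hT₁ hh
    have hj₂ : ∀ h ∈ T₂, (h ∈ A ∧ j h < e) ∧ Disjoint (F (j h) * {h}) E :=
      fun h hh => by simpa using hT₂ hh
    have hdisj : Disjoint T₁ T₂ := by
      rw [Finset.disjoint_left]
      intro h h1 h2
      have := hj₁ h h1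
      have := hj₂ h h2
      omega
    have hbi : ((T₁ ∪ T₂).biUnion fun h => F (j h) * {h}) = E ∪ U := by
      rw [Finset.union_biUnion]
      congr 1
      ext g
      simp only [hE, Finset.mem_biUnion, Finset.mem_mul, Finset.mem_singleton, exists_eq_left]
      constructor
      · rintro ⟨h, hh, s, hs, rfl⟩
        exact ⟨s, (hj₁ h hh).2 ▸ hs, h, hh, rfl⟩
      · rintro ⟨s, hs, h, hh, rfl⟩
        exact ⟨h, hh, s, (hj₁ h hh).2.symm ▸ hs, rfl⟩
    have hEU : Disjoint E U := by
      rw [hU, Finset.disjoint_biUnion_right]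
      exact fun h hh => (hj₂ h hh).2.symm
    have hcard : ((E ∪ U).card : ℝ) = E.card + U.card := by
      rw [Finset.card_union_of_disjoint hEU]; push_cast; ring
    refine ⟨T₁ ∪ T₂, ?_, ?_, ?_⟩
    · refine Finset.union_subset (fun h hh => (hj₁ h hh).1) fun h hh => (hj₂ h hh).1.1
    · rw [hbi, hcard, Finset.sum_union hdisj]
      have : ∑ h ∈ T₁, ((F (j h)).card : ℝ) = (F e).card * T₁.card := by
        rw [Finset.sum_congr rfl fun h hh => by rw [(hj₁ h hh).2]]
        simp [mul_comm]
      rw [this]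
      linarith
    · rw [hbi, hcard]
      have hsub : A ⊆ (A.filter fun h => j h = e) ∪
          (((A.filter fun h => j h < e).filter fun h => Disjoint (F (j h) * {h}) E) ∪
          ((Finset.range e).biUnion fun k => (F k)⁻¹ * F e) * T₁) := by
        intro h hh
        have h1 := hA h hh
        simp only [Finset.mem_union, Finset.mem_filter]
        by_cases h2 : j h = e
        · exact Or.inl ⟨hh, h2⟩
        · by_cases h3 : Disjoint (F (j h) * {h}) E
          · exact Or.inr (Or.inl ⟨⟨hh, by omega⟩, h3⟩)
          · refine Or.inr (Or.inr ?_)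
            obtain ⟨g, hg1, hg2⟩ := Finset.not_disjoint_iff.1 h3
            obtain ⟨s, hs, rfl⟩ := mem_mul_singleton_iff.1 hg1
            obtain ⟨a, ha, t, ht, hat⟩ := Finset.mem_mul.1 hg2
            refine Finset.mem_mul.2 ⟨s⁻¹ * a, ?_, t, ht, ?_⟩
            · exact Finset.mem_biUnion.2 ⟨j h, Finset.mem_range.2 (by omega),
                Finset.mul_mem_mul (Finset.inv_mem_inv hs) ha⟩
            · rw [mul_assoc, hat]; simp
      have h1 := Finset.card_le_card hsub
      have h2 := h1.trans ((Finset.card_union_le _ _).trans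
        (Nat.add_le_add_left (Finset.card_union_le _ _) _))
      have h3 : ((((Finset.range e).biUnion fun k => (F k)⁻¹ * F e) * T₁).card : ℝ) ≤
          C * (F e).card * T₁.card := by
        refine le_trans (Nat.cast_le.2 Finset.card_mul_le) ?_
        push_cast
        exact mul_le_mul_of_nonneg_right (hF e) (by positivity)
      have h4 : (A.card : ℝ) ≤ (A.filter fun h => j h = e).card +
          (((A.filter fun h => j h < e).filter fun h => Disjoint (F (j h) * {h}) E).card +
          (((Finset.range e).biUnion fun k => (F k)⁻¹ * F e) * T₁).card) := by exact_mod_cast h2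
      have h5 : ((A.filter fun h => j h = e).card : ℝ) ≤ 1 / ε * E.card := by
        rw [one_div, ← div_eq_inv_mul, le_div_iff₀ hε]; linarith
      have h6 : ((F e).card : ℝ) * T₁.card ≤ 2 * E.card := by
        have : (0 : ℝ) ≤ (F e).card * T₁.card := by positivity
        nlinarith
      have h7 := mul_le_mul_of_nonneg_left h6 hC.le
      linarith

/-- The union of the right translates `F n * {h}` over the pairs `(h, n)` in `T`. -/
def tileCover (F : ℕ → Finset G) (T : Finset (G × ℕ)) : Finset G :=
  T.biUnion fun q => F q.2 * {q.1}

/-- `S` is `(K, η)`-invariant. -/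
def IsAlmostInvariant (K : Finset G) (η : ℝ) (S : Finset G) : Prop :=
  ∑ g ∈ K, ((symmDiff S (S.image fun h => g⁻¹ * h)).card : ℝ) ≤ η * S.card

theorem IsFolnerSeq.eventually_isAlmostInvariant {F : ℕ → Finset G} (hF : IsFolnerSeq F)
    (K : Finset G) {η : ℝ} (hη : 0 < η) :
    ∃ N, ∀ n, N ≤ n → IsAlmostInvariant K η (F n) := by
  have h := tendsto_finsetSum K fun g _ => hF.2 g⁻¹
  rw [Finset.sum_const_zero] at h
  obtain ⟨N, hN⟩ := eventually_atTop.1 (h.eventually (gt_mem_nhds hη))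
  refine ⟨N, fun n hn => ?_⟩
  have hpos : (0 : ℝ) < (F n).card := by exact_mod_cast (hF.1 n).card_pos
  have := hN n hn
  rw [← Finset.sum_div, div_lt_iff₀ hpos] at this
  exact this.le

theorem IsAlmostInvariant.card_exists_notMem_le {K S : Finset G} {η : ℝ}
    (h : IsAlmostInvariant K η S) :
    ((S.filter fun x => ∃ g ∈ K, g * x ∉ S).card : ℝ) ≤ η * S.card := by
  refine le_trans ?_ h
  have hsub : (S.filter fun x => ∃ g ∈ K, g * x ∉ S) ⊆
      K.biUnion fun g => symmDiff S (S.image fun h => g⁻¹ * h) := by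
    intro x hx
    obtain ⟨hxS, g, hg, hgx⟩ := Finset.mem_filter.1 hx
    refine Finset.mem_biUnion.2 ⟨g, hg, Finset.mem_symmDiff.2 (Or.inl ⟨hxS, ?_⟩)⟩
    intro hmem
    obtain ⟨y, hy, rfl⟩ := Finset.mem_image.1 hmem
    simp [hy] at hgx
  exact_mod_cast (Finset.card_le_card hsub).trans Finset.card_biUnion_le

theorem IsAlmostInvariant.card_biUnion_sdiff_le {K S : Finset G} {η : ℝ}
    (h : IsAlmostInvariant K η S) :
    (((K.biUnion fun g => S.image fun h => g⁻¹ * h) \ S).card : ℝ) ≤ η * S.card := by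
  refine le_trans ?_ h
  have hsub : ((K.biUnion fun g => S.image fun h => g⁻¹ * h) \ S) ⊆
      K.biUnion fun g => symmDiff S (S.image fun h => g⁻¹ * h) := by
    intro x hx
    obtain ⟨h1, h2⟩ := Finset.mem_sdiff.1 hx
    obtain ⟨g, hg, hgx⟩ := Finset.mem_biUnion.1 h1
    exact Finset.mem_biUnion.2 ⟨g, hg, Finset.mem_symmDiff.2 (Or.inr ⟨hgx, h2⟩)⟩
  exact_mod_cast (Finset.card_le_card hsub).trans Finset.card_biUnion_le

theorem card_sdiff_tileCover_le {F : ℕ → Finset G} {D K : Finset G} {T : Finset (G × ℕ)}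
    {η ε : ℝ} (hη : 0 ≤ η) (hε1 : ε ≤ 1 / 2) (hD : IsAlmostInvariant K η D)
    (hT : ∀ q ∈ T, IsAlmostInvariant K η (F q.2)) (hTD : tileCover F T ⊆ D)
    (hmass : (1 - ε) * ∑ q ∈ T, ((F q.2).card : ℝ) ≤ (tileCover F T).card) :
    ((D \ tileCover F T).card : ℝ) ≤
      ((D \ tileCover F T).filter fun h => ∀ g ∈ K, g * h ∈ D \ tileCover F T).card +
        3 * η * D.card := by
  set R := D \ tileCover F T with hR
  have hsub : R ⊆ (R.filter fun h => ∀ g ∈ K, g * h ∈ R) ∪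
      ((D.filter fun x => ∃ g ∈ K, g * x ∉ D) ∪
        T.biUnion fun q =>
          ((K.biUnion fun g => (F q.2).image fun h => g⁻¹ * h) \ F q.2) * {q.1}) := by
    intro x hx
    obtain ⟨hxD, hxT⟩ := Finset.mem_sdiff.1 hx
    simp only [Finset.mem_union, Finset.mem_filter]
    by_cases h1 : ∀ g ∈ K, g * x ∈ R
    · exact Or.inl ⟨hx, h1⟩
    by_cases h2 : ∃ g ∈ K, g * x ∉ D
    · exact Or.inr (Or.inl ⟨hxD, h2⟩)
    push Not at h1 h2
    obtain ⟨g, hg, hgx⟩ := h1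
    have h3 : g * x ∈ tileCover F T := by
      by_contra h4
      exact hgx (Finset.mem_sdiff.2 ⟨h2 g hg, h4⟩)
    obtain ⟨q, hq, hgq⟩ := Finset.mem_biUnion.1 h3
    obtain ⟨s, hs, hsq⟩ := mem_mul_singleton_iff.1 hgq
    refine Or.inr (Or.inr (Finset.mem_biUnion.2 ⟨q, hq, mem_mul_singleton_iff.2
      ⟨g⁻¹ * s, Finset.mem_sdiff.2 ⟨?_, ?_⟩, ?_⟩⟩))
    · exact Finset.mem_biUnion.2 ⟨g, hg, Finset.mem_image.2 ⟨s, hs, rfl⟩⟩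
    · intro h5
      refine hxT (Finset.mem_biUnion.2 ⟨q, hq, mem_mul_singleton_iff.2 ⟨_, h5, ?_⟩⟩)
      rw [mul_assoc, hsq]; simp
    · rw [mul_assoc, hsq]; simp
  have h1 := (Finset.card_le_card hsub).trans ((Finset.card_union_le _ _).trans
    (Nat.add_le_add_left ((Finset.card_union_le _ _).trans
      (Nat.add_le_add_left Finset.card_biUnion_le _)) _))
  simp only [Finset.card_mul_singleton] at h1
  have h2 : (R.card : ℝ) ≤ (R.filter fun h => ∀ g ∈ K, g * h ∈ R).card +
      ((D.filter fun x => ∃ g ∈ K, g * x ∉ D).card + ∑ q ∈ T,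
        (((K.biUnion fun g => (F q.2).image fun h => g⁻¹ * h) \ F q.2).card : ℝ)) := by
    exact_mod_cast h1
  have h3 : ∑ q ∈ T, (((K.biUnion fun g => (F q.2).image fun h => g⁻¹ * h) \ F q.2).card : ℝ) ≤
      η * ∑ q ∈ T, ((F q.2).card : ℝ) := by
    rw [Finset.mul_sum]
    exact Finset.sum_le_sum fun q hq => (hT q hq).card_biUnion_sdiff_le
  have h4 := hD.card_exists_notMem_le
  have h5 : ((tileCover F T).card : ℝ) ≤ D.card := by exact_mod_cast Finset.card_le_card hTD
  have h6 : ∑ q ∈ T, ((F q.2).card : ℝ) ≤ 2 * D.card := by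
    have : 0 ≤ ∑ q ∈ T, ((F q.2).card : ℝ) := Finset.sum_nonneg fun _ _ => by positivity
    nlinarith
  have h7 := mul_le_mul_of_nonneg_left h6 hη
  linarith

/-- One step of the layered covering: filling part of the uncovered region by tiles that are
small with respect to those already placed. -/
theorem exists_tileCover_extend {F : ℕ → Finset G} (hne : ∀ n, (F n).Nonempty) {C ε : ℝ}
    (hC : 0 < C)
    (hF : ∀ n, ((((Finset.range n).biUnion fun k => (F k)⁻¹ * F n)).card : ℝ) ≤
      C * ((F n).card : ℝ))
    (hε : 0 < ε) (hε1 : ε ≤ 1 / 2) {j : G → ℕ} {e : ℕ} (hj : ∀ h, j h < e)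
    {D : Finset G} {T : Finset (G × ℕ)}
    (hD : IsAlmostInvariant ((Finset.range e).biUnion F) (ε / 6) D)
    (hT : ∀ q ∈ T, IsAlmostInvariant ((Finset.range e).biUnion F) (ε / 6) (F q.2))
    (hTD : tileCover F T ⊆ D)
    (hmass : (1 - ε) * ∑ q ∈ T, ((F q.2).card : ℝ) ≤ (tileCover F T).card)
    (hbig : ε * D.card ≤ ((D \ tileCover F T).card : ℝ)) :
    ∃ T' : Finset (G × ℕ), (∀ q ∈ T', q ∈ T ∨ q.1 ∈ D ∧ q.2 = j q.1) ∧ tileCover F T' ⊆ D ∧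
      (1 - ε) * ∑ q ∈ T', ((F q.2).card : ℝ) ≤ (tileCover F T').card ∧
      ((D \ tileCover F T').card : ℝ) ≤
        (1 - 1 / (2 * (1 / ε + 2 * C))) * (D \ tileCover F T).card := by
  classical
  have hA := card_sdiff_tileCover_le (by positivity) hε1 hD hT hTD hmass
  set R := D \ tileCover F T with hR
  set A := R.filter fun h => ∀ g ∈ (Finset.range e).biUnion F, g * h ∈ R with hAdef
  obtain ⟨T₁, hT₁, hm₁, hc₁⟩ :=
    exists_almostDisjoint_tiles hne hC hF hε hε1 j e A fun h _ => hj h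
  set E := T₁.biUnion fun h => F (j h) * {h} with hE
  have hER : E ⊆ R := by
    intro g hg
    obtain ⟨h, hh, hgh⟩ := Finset.mem_biUnion.1 hg
    obtain ⟨s, hs, rfl⟩ := mem_mul_singleton_iff.1 hgh
    exact (Finset.mem_filter.1 (hT₁ hh)).2 s
      (Finset.mem_biUnion.2 ⟨j h, Finset.mem_range.2 (hj h), hs⟩)
  set T₂ := T₁.image fun h => (h, j h) with hT₂
  have hE₂ : tileCover F T₂ = E := by
    rw [tileCover, hT₂, Finset.image_biUnion]
  have hcov : tileCover F (T ∪ T₂) = tileCover F T ∪ E := by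
    rw [← hE₂, tileCover, Finset.union_biUnion]; rfl
  have hdis : Disjoint (tileCover F T) E :=
    Finset.disjoint_of_subset_right hER Finset.disjoint_sdiff
  have hcard : ((tileCover F T ∪ E).card : ℝ) = (tileCover F T).card + E.card := by
    rw [Finset.card_union_of_disjoint hdis]; push_cast; ring
  refine ⟨T ∪ T₂, ?_, ?_, ?_, ?_⟩
  · intro q hq
    rcases Finset.mem_union.1 hq with hq | hq
    · exact Or.inl hq
    · obtain ⟨h, hh, rfl⟩ := Finset.mem_image.1 hq
      exact Or.inr ⟨(Finset.mem_sdiff.1 (Finset.mem_filter.1 (hT₁ hh)).1).1, rfl⟩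
  · rw [hcov]
    exact Finset.union_subset hTD (hER.trans Finset.sdiff_subset)
  · rw [hcov, hcard]
    have h1 : ∑ q ∈ T ∪ T₂, ((F q.2).card : ℝ) ≤
        ∑ q ∈ T, ((F q.2).card : ℝ) + ∑ q ∈ T₂, ((F q.2).card : ℝ) := by
      rw [← Finset.sum_union_inter]
      exact le_add_of_nonneg_right (Finset.sum_nonneg fun _ _ => by positivity)
    have h2 : ∑ q ∈ T₂, ((F q.2).card : ℝ) = ∑ h ∈ T₁, ((F (j h)).card : ℝ) := by
      rw [hT₂, Finset.sum_image]
      intro a _ b _ hab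
      exact (Prod.mk.inj hab).1
    have h3 := mul_le_mul_of_nonneg_left h1 (by linarith : (0 : ℝ) ≤ 1 - ε)
    rw [h2] at h3
    linarith
  · have h1 : D \ tileCover F (T ∪ T₂) = R \ E := by
      rw [hcov, hR, sdiff_sdiff_left]; rfl
    have h2 : ((R \ E).card : ℝ) = R.card - E.card := by
      rw [Finset.card_sdiff_of_subset hER, Nat.cast_sub (Finset.card_le_card hER)]
    have hK : 0 < 1 / ε + 2 * C := by positivity
    rw [h1, h2]
    have h3 : (R.card : ℝ) / 2 ≤ (1 / ε + 2 * C) * E.card := by linarith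
    have h4 : 1 / (2 * (1 / ε + 2 * C)) * R.card ≤ E.card := by
      rw [one_div, inv_mul_le_iff₀ (by positivity)]
      linarith
    linarith

/-- Covering lemma: given sufficiently many layers of tiles, all but a small proportion of `F n`
can be covered by almost disjoint tiles. -/
theorem exists_layered_tiling {F : ℕ → Finset G} (hFol : IsFolnerSeq F) {C ε : ℝ}
    (hC : 0 < C)
    (hF : ∀ n, ((((Finset.range n).biUnion fun k => (F k)⁻¹ * F n)).card : ℝ) ≤
      C * ((F n).card : ℝ))
    (hε : 0 < ε) (hε1 : ε ≤ 1 / 2) (E : ℕ → ℕ) (k : ℕ) :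
    ∀ b : ℕ, ∃ B : Finset ℕ, B.card ≤ k ∧ ∃ N, ∀ n, N ≤ n → ∀ j : ℕ → G → ℕ,
      (∀ i h, i ≤ j i h ∧ j i h < E i) → ∃ T : Finset (G × ℕ),
        (∀ q ∈ T, q.1 ∈ F n ∧ b ≤ q.2 ∧ ∃ i ∈ B, q.2 = j i q.1) ∧ tileCover F T ⊆ F n ∧
        (1 - ε) * ∑ q ∈ T, ((F q.2).card : ℝ) ≤ (tileCover F T).card ∧
        (((F n \ tileCover F T).card : ℝ) ≤ ε * (F n).card ∨
          ((F n \ tileCover F T).card : ℝ) ≤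
            (1 - 1 / (2 * (1 / ε + 2 * C))) ^ k * (F n).card) := by
  have hθ : 0 ≤ 1 - 1 / (2 * (1 / ε + 2 * C)) := by
    have : 1 ≤ 1 / ε := by rw [le_div_iff₀ hε]; linarith
    rw [sub_nonneg, div_le_one (by positivity)]
    linarith
  induction k with
  | zero =>
    intro b
    exact ⟨∅, by simp, 0, fun n _ j _ => ⟨∅, by simp [tileCover]⟩⟩
  | succ k ih =>
    intro b
    obtain ⟨N₁, hN₁⟩ := hFol.eventually_isAlmostInvariant ((Finset.range (E b)).biUnion F)
      (η := ε / 6) (by positivity)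
    obtain ⟨B, hB, N₂, hN₂⟩ := ih (max b N₁)
    refine ⟨insert b B, (Finset.card_insert_le _ _).trans (by omega), max N₁ N₂, ?_⟩
    intro n hn j hj
    obtain ⟨T, hT, hTD, hmass, hres⟩ := hN₂ n (le_trans (le_max_right _ _) hn) j hj
    have hT' : ∀ q ∈ T, q.1 ∈ F n ∧ b ≤ q.2 ∧ ∃ i ∈ insert b B, q.2 = j i q.1 := by
      intro q hq
      obtain ⟨h1, h2, i, hi, h3⟩ := hT q hq
      exact ⟨h1, (le_max_left _ _).trans h2, i, Finset.mem_insert_of_mem hi, h3⟩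
    by_cases hbig : ((F n \ tileCover F T).card : ℝ) ≤ ε * (F n).card
    · exact ⟨T, hT', hTD, hmass, Or.inl hbig⟩
    · have hres := hres.resolve_left hbig
      obtain ⟨T', h1, h2, h3, h4⟩ := exists_tileCover_extend hFol.1 hC hF hε hε1
        (fun h => (hj b h).2) (hN₁ n ((le_max_left _ _).trans hn))
        (fun q hq => hN₁ _ ((le_max_right _ _).trans (hT q hq).2.1)) hTD hmass
        (not_le.1 hbig).le
      refine ⟨T', ?_, h2, h3, Or.inr ?_⟩
      · intro q hq
        rcases h1 q hq with h5 | ⟨h5, h6⟩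
        · exact hT' q h5
        · exact ⟨h5, h6 ▸ (hj b q.1).1, b, Finset.mem_insert_self _ _, h6⟩
      · calc _ ≤ _ := h4
          _ ≤ _ := mul_le_mul_of_nonneg_left hres hθ
          _ = _ := by ring

end Covering

section Counting

theorem isOpen_nameSet {G : Type*} [Group G] {X : Type*} [TopologicalSpace X] [MulAction G X]
    [ContinuousConstSMul G X] {F : Finset G} {u : G → Set X}
    (hu : ∀ g ∈ F, IsOpen (u g)) : IsOpen (nameSet F u) := by
  have : nameSet F u = ⋂ g ∈ F, (fun x => g • x) ⁻¹' u g := by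
    ext x; simp [nameSet]
  rw [this]
  exact isOpen_biInter_finset fun g hg => (hu g hg).preimage (continuous_const_smul g)

/-- By compactness, vanishing of `bowenM` gives finite covers by names of small total weight. -/
theorem exists_finset_of_bowenM_eq_zero {G : Type*} [Group G] {X : Type*} [TopologicalSpace X]
    [MulAction G X] [CompactSpace X] [ContinuousConstSMul G X]
    {F : ℕ → Finset G} {𝒰 : Finset (Set X)} (h𝒰 : ∀ V ∈ 𝒰, IsOpen V) {N : ℕ} {s : ℝ}
    (h : bowenM F 𝒰 (Set.univ : Set X) N s = 0) {δ : ℝ} (hδ : 0 < δ) :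
    ∃ P : Finset (ℕ × (G → Set X)), (∀ p ∈ P, N ≤ p.1 ∧ ∀ g ∈ F p.1, p.2 g ∈ 𝒰) ∧
      (∀ x : X, ∃ p ∈ P, x ∈ nameSet (F p.1) p.2) ∧
      ∑ p ∈ P, Real.exp (-s * ((F p.1).card : ℝ)) ≤ δ := by
  have hlt : bowenM F 𝒰 (Set.univ : Set X) N s < ENNReal.ofReal δ := by
    rw [h]; exact ENNReal.ofReal_pos.2 hδ
  simp only [bowenM, iInf_lt_iff] at hlt
  obtain ⟨Λ, hΛ, hcov, hsum⟩ := hlt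
  obtain ⟨b, hb, hbf, hbc⟩ := isCompact_univ.elim_finite_subcover_image
    (fun p hp => isOpen_nameSet fun g hg => h𝒰 _ ((hΛ p hp).2 g hg)) hcov
  refine ⟨hbf.toFinset, fun p hp => hΛ p (hb (hbf.mem_toFinset.1 hp)), fun x => ?_, ?_⟩
  · obtain ⟨p, hp, hx⟩ := Set.mem_iUnion₂.1 (hbc (Set.mem_univ x))
    exact ⟨p, hbf.mem_toFinset.2 hp, hx⟩
  · rw [← ENNReal.ofReal_le_ofReal_iff hδ.le,
      ENNReal.ofReal_sum_of_nonneg fun p _ => (Real.exp_pos _).le]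
    refine le_trans ?_ hsum.le
    rw [tsum_subtype Λ fun p => ENNReal.ofReal (Real.exp (-s * ((F p.1).card : ℝ)))]
    refine le_trans (le_of_eq (Finset.sum_congr rfl fun p hp => ?_))
      (ENNReal.sum_le_tsum hbf.toFinset)
    rw [Set.indicator_of_mem (hb (hbf.mem_toFinset.1 hp))]

theorem sum_biUnion_le {ι α : Type*} [DecidableEq ι] [DecidableEq α] (B : Finset ι)
    (P : ι → Finset α) {f : α → ℝ} (hf : ∀ a, 0 ≤ f a) :
    ∑ a ∈ B.biUnion P, f a ≤ ∑ i ∈ B, ∑ a ∈ P i, f a := by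
  induction B using Finset.induction_on with
  | empty => simp
  | insert i B hi ih =>
    rw [Finset.biUnion_insert, Finset.sum_insert hi]
    have h1 := Finset.sum_union_inter (s₁ := P i) (s₂ := B.biUnion P) (f := f)
    have h2 : 0 ≤ ∑ a ∈ P i ∩ B.biUnion P, f a := Finset.sum_nonneg fun a _ => hf a
    linarith

variable {G : Type*} [Group G] [DecidableEq G] {X : Type*}

/-- The part of `G` covered by the translates `F n * {h}` of the domains of the names `(n, u)`
with `(h, (n, u)) ∈ t`. -/
def namesCover (F : ℕ → Finset G) (t : Finset (G × (ℕ × (G → Set X)))) : Finset G :=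
  t.biUnion fun q => F q.2.1 * {q.1}

open Classical in
/-- The name obtained by gluing translated names `t` with a name `ρ` on the rest of `D`. -/
noncomputable def glueName (F : ℕ → Finset G) (D : Finset G)
    (t : Finset (G × (ℕ × (G → Set X)))) (ρ : ∀ g ∈ D \ namesCover F t, Set X) (g : G) : Set X :=
  if h : g ∈ D \ namesCover F t then ρ g h
  else if h' : ∃ q ∈ t, g ∈ F q.2.1 * {q.1} then h'.choose.2.2 (g * h'.choose.1⁻¹) else ∅

variable [MulAction G X]

open Classical in
theorem covNum_le_sum (F : ℕ → Finset G) (𝒰 : Finset (Set X))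
    (h𝒰 : (Set.univ : Set X) ⊆ ⋃₀ (𝒰 : Set (Set X))) (D : Finset G)
    (𝒯 : Finset (Finset (G × (ℕ × (G → Set X)))))
    (hvalid : ∀ t ∈ 𝒯, ∀ q ∈ t, ∀ g ∈ F q.2.1, q.2.2 g ∈ 𝒰)
    (hcov : ∀ x : X, ∃ t ∈ 𝒯, ∀ q ∈ t, q.1 • x ∈ nameSet (F q.2.1) q.2.2) :
    covNum 𝒰 D (Set.univ : Set X) ≤ ∑ t ∈ 𝒯, 𝒰.card ^ (D \ namesCover F t).card := by
  set Λ := 𝒯.biUnion fun t =>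
    (Finset.pi (D \ namesCover F t) fun _ => 𝒰).image (glueName F D t) with hΛ
  have hle : covNum 𝒰 D (Set.univ : Set X) ≤ Λ.card := by
    refine Nat.sInf_le ⟨Λ, rfl, ?_, ?_⟩
    · intro u hu g hg
      obtain ⟨t, ht, hu⟩ := Finset.mem_biUnion.1 hu
      obtain ⟨ρ, hρ, rfl⟩ := Finset.mem_image.1 hu
      by_cases h : g ∈ D \ namesCover F t
      · rw [glueName, dif_pos h]
        exact Finset.mem_pi.1 hρ g h
      · have h' : ∃ q ∈ t, g ∈ F q.2.1 * {q.1} := by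
          by_contra h2
          exact h (Finset.mem_sdiff.2 ⟨hg, fun h3 => h2 (Finset.mem_biUnion.1 h3)⟩)
        rw [glueName, dif_neg h, dif_pos h']
        refine hvalid t ht _ h'.choose_spec.1 _ ?_
        obtain ⟨s, hs, hsg⟩ := mem_mul_singleton_iff.1 h'.choose_spec.2
        exact eq_mul_inv_of_mul_eq hsg ▸ hs
    · intro x _
      obtain ⟨t, ht, hx⟩ := hcov x
      choose V hV using fun g : G => h𝒰 (Set.mem_univ (g • x))
      refine Set.mem_iUnion₂.2 ⟨glueName F D t fun g _ => V g, ?_, ?_⟩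
      · exact Finset.mem_biUnion.2 ⟨t, ht, Finset.mem_image.2
          ⟨_, Finset.mem_pi.2 fun g _ => (hV g).1, rfl⟩⟩
      · intro g hg
        by_cases h : g ∈ D \ namesCover F t
        · rw [glueName, dif_pos h]
          exact (hV g).2
        · have h' : ∃ q ∈ t, g ∈ F q.2.1 * {q.1} := by
            by_contra h2
            exact h (Finset.mem_sdiff.2 ⟨hg, fun h3 => h2 (Finset.mem_biUnion.1 h3)⟩)
          rw [glueName, dif_neg h, dif_pos h']
          obtain ⟨s, hs, hsg⟩ := mem_mul_singleton_iff.1 h'.choose_spec.2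
          have := hx _ h'.choose_spec.1 (g * h'.choose.1⁻¹) 
            (eq_mul_inv_of_mul_eq hsg ▸ hs)
          simpa [mul_smul] using this
  refine hle.trans (Finset.card_biUnion_le.trans (Finset.sum_le_sum fun t _ => ?_))
  refine Finset.card_image_le.trans ?_
  rw [Finset.card_pi, Finset.prod_const]

open Classical in
theorem covNum_le_exp (F : ℕ → Finset G) (𝒰 : Finset (Set X))
    (h𝒰 : (Set.univ : Set X) ⊆ ⋃₀ (𝒰 : Set (Set X))) (D : Finset G)
    (P : Finset (ℕ × (G → Set X))) (hP : ∀ p ∈ P, ∀ g ∈ F p.1, p.2 g ∈ 𝒰)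
    {s L r W : ℝ} (hs : 0 ≤ s)
    (hW : ∑ p ∈ P, Real.exp (-s * ((F p.1).card : ℝ)) ≤ W)
    (hcov : ∀ x : X, ∃ t ⊆ D ×ˢ P, (∀ q ∈ t, q.1 • x ∈ nameSet (F q.2.1) q.2.2) ∧
      ∑ q ∈ t, ((F q.2.1).card : ℝ) ≤ L ∧ ((D \ namesCover F t).card : ℝ) ≤ r) :
    (covNum 𝒰 D (Set.univ : Set X) : ℝ) ≤
      Real.exp (s * L + D.card * W + r * Real.log (𝒰.card + 1)) := by
  set 𝒯 := (D ×ˢ P).powerset.filter fun t =>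
    ∑ q ∈ t, ((F q.2.1).card : ℝ) ≤ L ∧ ((D \ namesCover F t).card : ℝ) ≤ r with h𝒯
  have h1 := covNum_le_sum F 𝒰 h𝒰 D 𝒯
    (by
      intro t ht q hq
      have := Finset.mem_powerset.1 (Finset.mem_filter.1 ht).1 hq
      exact hP _ (Finset.mem_product.1 this).2)
    (by
      intro x
      obtain ⟨t, h1, h2, h3⟩ := hcov x
      exact ⟨t, Finset.mem_filter.2 ⟨Finset.mem_powerset.2 h1, h3⟩, h2⟩)
  set w : G × (ℕ × (G → Set X)) → ℝ := fun q => Real.exp (-s * ((F q.2.1).card : ℝ)) with hw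
  have hlog : 0 ≤ Real.log (𝒰.card + 1) := Real.log_nonneg (by norm_cast; omega)
  have h2 : ∀ t ∈ 𝒯, ((𝒰.card : ℝ) ^ (D \ namesCover F t).card) ≤
      Real.exp (s * L + r * Real.log (𝒰.card + 1)) * ∏ q ∈ t, w q := by
    intro t ht
    obtain ⟨_, h3, h4⟩ := Finset.mem_filter.1 ht
    have h5 : ((𝒰.card : ℝ) ^ (D \ namesCover F t).card) ≤
        Real.exp ((D \ namesCover F t).card * Real.log (𝒰.card + 1)) := by
      rw [Real.exp_nat_mul, Real.exp_log (by positivity)]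
      exact pow_le_pow_left₀ (by positivity) (by linarith) _
    refine h5.trans ?_
    rw [hw, ← Real.exp_sum, ← Real.exp_add, ← Finset.mul_sum]
    refine Real.exp_le_exp.2 ?_
    have := mul_le_mul_of_nonneg_right h4 hlog
    have := mul_le_mul_of_nonneg_left h3 hs
    linarith
  have h3 : ∑ t ∈ 𝒯, ∏ q ∈ t, w q ≤ Real.exp (D.card * W) := by
    calc ∑ t ∈ 𝒯, ∏ q ∈ t, w q ≤ ∑ t ∈ (D ×ˢ P).powerset, ∏ q ∈ t, w q :=
          Finset.sum_le_sum_of_subset_of_nonneg (Finset.filter_subset _ _)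
            fun t _ _ => Finset.prod_nonneg fun q _ => (Real.exp_pos _).le
      _ = ∏ q ∈ D ×ˢ P, (1 + w q) := (Finset.prod_one_add _).symm
      _ ≤ ∏ q ∈ D ×ˢ P, Real.exp (w q) :=
          Finset.prod_le_prod (fun q _ => add_nonneg zero_le_one (Real.exp_pos _).le) fun q _ => by
            rw [add_comm]; exact Real.add_one_le_exp _
      _ = Real.exp (D.card * ∑ p ∈ P, Real.exp (-s * ((F p.1).card : ℝ))) := by
          rw [← Real.exp_sum, Finset.sum_product]
          simp [hw]
      _ ≤ _ := Real.exp_le_exp.2 (mul_le_mul_of_nonneg_left hW (by positivity))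
  calc (covNum 𝒰 D (Set.univ : Set X) : ℝ)
      ≤ ∑ t ∈ 𝒯, (𝒰.card : ℝ) ^ (D \ namesCover F t).card := by exact_mod_cast h1
    _ ≤ ∑ t ∈ 𝒯, Real.exp (s * L + r * Real.log (𝒰.card + 1)) * ∏ q ∈ t, w q :=
        Finset.sum_le_sum h2
    _ ≤ Real.exp (s * L + r * Real.log (𝒰.card + 1)) * Real.exp (D.card * W) := by
        rw [← Finset.mul_sum]
        exact mul_le_mul_of_nonneg_left h3 (Real.exp_pos _).le
    _ = _ := by rw [← Real.exp_add]; congr 1; ring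

variable [TopologicalSpace X]

theorem eventually_log_covNum_le [CompactSpace X] [ContinuousConstSMul G X]
    {F : ℕ → Finset G} (hFol : IsFolnerSeq F) (hTemp : IsTemperedSeq F) {𝒰 : Finset (Set X)}
    (h𝒰 : IsFiniteOpenCoverOn 𝒰 (Set.univ : Set X)) {s : ℝ} (hs : 0 ≤ s)
    (h : bowenMlim F 𝒰 (Set.univ : Set X) s = 0) {ε : ℝ} (hε : 0 < ε) (hε1 : ε ≤ 1 / 2) :
    ∃ N, ∀ n, N ≤ n → Real.log (covNum 𝒰 (F n) (Set.univ : Set X)) / (F n).card ≤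
      s + ε * (2 * s + 1 + Real.log (𝒰.card + 1)) := by
  classical
  obtain ⟨C, hC, hF⟩ := hTemp
  have hlog : 0 ≤ Real.log (𝒰.card + 1) := Real.log_nonneg (by norm_cast; omega)
  set θ := 1 - 1 / (2 * (1 / ε + 2 * C)) with hθ
  have hθ1 : θ < 1 := by
    have : 0 < 1 / (2 * (1 / ε + 2 * C)) := by positivity
    linarith
  obtain ⟨k, hk⟩ : ∃ k : ℕ, θ ^ k ≤ ε := by
    have hθ0 : 0 ≤ θ := by
      have : 1 ≤ 1 / ε := by rw [le_div_iff₀ hε]; linarith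
      rw [hθ, sub_nonneg, div_le_one (by positivity)]
      linarith
    exact (exists_pow_lt_of_lt_one hε hθ1).imp fun _ h => h.le
  have hM : ∀ N, bowenM F 𝒰 (Set.univ : Set X) N s = 0 := fun N =>
    le_antisymm ((le_iSup (fun N => bowenM F 𝒰 (Set.univ : Set X) N s) N).trans h.le) zero_le
  have hδ : 0 < ε / (k + 1) := by positivity
  choose P hPvalid hPcov hPsum using fun N => exists_finset_of_bowenM_eq_zero h𝒰.1 (hM N) hδ
  obtain ⟨B, hB, N, hN⟩ := exists_layered_tiling hFol hC hF hε hε1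
    (fun N => (P N).sup Prod.fst + 1) k 0
  refine ⟨N, fun n hn => ?_⟩
  have hcardpos : (0 : ℝ) < (F n).card := by exact_mod_cast (hFol.1 n).card_pos
  have hbound := covNum_le_exp F 𝒰 h𝒰.2 (F n) (B.biUnion P) (s := s)
    (L := (1 + 2 * ε) * (F n).card) (r := ε * (F n).card) (W := ε)
    (by
      intro p hp
      obtain ⟨i, _, hi⟩ := Finset.mem_biUnion.1 hp
      exact (hPvalid i p hi).2)
    hs
    (by
      calc ∑ p ∈ B.biUnion P, Real.exp (-s * ((F p.1).card : ℝ))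
          ≤ ∑ i ∈ B, ∑ p ∈ P i, Real.exp (-s * ((F p.1).card : ℝ)) :=
            sum_biUnion_le B P fun p => (Real.exp_pos _).le
        _ ≤ ∑ i ∈ B, ε / (k + 1) := Finset.sum_le_sum fun i _ => hPsum i
        _ = B.card * (ε / (k + 1)) := by simp
        _ ≤ (k + 1) * (ε / (k + 1)) := by
            refine mul_le_mul_of_nonneg_right ?_ hδ.le
            have : (B.card : ℝ) ≤ k := by exact_mod_cast hB
            linarith
        _ = ε := by field_simp)
    (by
      intro x
      choose p hpP hpx using fun (i : ℕ) (g : G) => hPcov i (g • x)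
      obtain ⟨T, hT, hTD, hmass, hres⟩ := hN n hn (fun i g => (p i g).1) fun i g =>
        ⟨(hPvalid i _ (hpP i g)).1, Nat.lt_succ_of_le (Finset.le_sup (f := Prod.fst) (hpP i g))⟩
      have hex : ∀ q : G × ℕ, ∃ u : G → Set X, q ∈ T →
          (q.2, u) ∈ B.biUnion P ∧ q.1 • x ∈ nameSet (F q.2) u := by
        intro q
        by_cases hq : q ∈ T
        · obtain ⟨_, _, i, hi, h1⟩ := hT q hq
          refine ⟨(p i q.1).2, fun _ => ⟨Finset.mem_biUnion.2 ⟨i, hi, ?_⟩, ?_⟩⟩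
          · rw [h1]; exact hpP i q.1
          · rw [h1]; exact hpx i q.1
        · exact ⟨fun _ => ∅, fun h => absurd h hq⟩
      choose u hu using hex
      have hcov : namesCover F (T.image fun q => (q.1, (q.2, u q))) = tileCover F T := by
        rw [namesCover, tileCover, Finset.image_biUnion]
      refine ⟨T.image fun q => (q.1, (q.2, u q)), ?_, ?_, ?_, ?_⟩
      · intro y hy
        obtain ⟨q, hq, rfl⟩ := Finset.mem_image.1 hy
        exact Finset.mem_product.2 ⟨(hT q hq).1, (hu q hq).1⟩
      · intro y hy
        obtain ⟨q, hq, rfl⟩ := Finset.mem_image.1 hy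
        exact (hu q hq).2
      · rw [Finset.sum_image (by
          intro a _ b _ hab
          simp only [Prod.mk.injEq] at hab
          exact Prod.ext hab.1 hab.2.1)]
        have h1 : ((tileCover F T).card : ℝ) ≤ (F n).card := by
          exact_mod_cast Finset.card_le_card hTD
        have h2 : 1 ≤ (1 + 2 * ε) * (1 - ε) := by nlinarith
        have h3 : 0 ≤ ∑ q ∈ T, ((F q.2).card : ℝ) := Finset.sum_nonneg fun _ _ => by positivity
        calc ∑ q ∈ T, ((F q.2).card : ℝ)
            ≤ (1 + 2 * ε) * ((1 - ε) * ∑ q ∈ T, ((F q.2).card : ℝ)) := by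
              rw [← mul_assoc]; exact le_mul_of_one_le_left h3 h2
          _ ≤ (1 + 2 * ε) * (F n).card :=
              mul_le_mul_of_nonneg_left (hmass.trans h1) (by positivity)
      · rw [hcov]
        rcases hres with h1 | h1
        · exact h1
        · exact h1.trans (mul_le_mul_of_nonneg_right hk hcardpos.le))
  rw [div_le_iff₀ hcardpos]
  have hrhs : s * ((1 + 2 * ε) * (F n).card) + (F n).card * ε +
      ε * (F n).card * Real.log (𝒰.card + 1) =
      (s + ε * (2 * s + 1 + Real.log (𝒰.card + 1))) * (F n).card := by ring
  rw [hrhs] at hbound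
  rcases Nat.eq_zero_or_pos (covNum 𝒰 (F n) (Set.univ : Set X)) with h0 | h0
  · rw [h0, Nat.cast_zero, Real.log_zero]
    positivity
  · rwa [Real.log_le_iff_le_exp (by exact_mod_cast h0)]

theorem coverEntropyOf_le_of_bowenMlim_eq_zero [CompactSpace X] [ContinuousConstSMul G X]
    {F : ℕ → Finset G} (hFol : IsFolnerSeq F) (hTemp : IsTemperedSeq F) {𝒰 : Finset (Set X)}
    (h𝒰 : IsFiniteOpenCoverOn 𝒰 (Set.univ : Set X)) {s : ℝ≥0}
    (h : bowenMlim F 𝒰 (Set.univ : Set X) s = 0) :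
    coverEntropyOf F 𝒰 (Set.univ : Set X) ≤ s := by
  have hlog : 0 ≤ Real.log (𝒰.card + 1) := Real.log_nonneg (by norm_cast; omega)
  set c : ℝ := 2 * s + 1 + Real.log (𝒰.card + 1) with hc
  have hcpos : 0 < c := by have := s.2; positivity
  refine ENNReal.le_of_forall_pos_le_add fun δ hδ _ => ?_
  have hδ' : (0 : ℝ) < δ := hδ
  obtain ⟨N, hN⟩ := eventually_log_covNum_le hFol hTemp h𝒰 s.2 h
    (ε := min (1 / 2) (δ / c)) (by positivity) (min_le_left _ _)
  refine limsup_le_of_le (h := ?_)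
  filter_upwards [eventually_ge_atTop N] with n hn
  rw [← ENNReal.coe_add, ← ENNReal.ofReal_coe_nnreal]
  refine ENNReal.ofReal_le_ofReal ((hN n hn).trans ?_)
  rw [NNReal.coe_add]
  have h1 : min (1 / 2) (δ / c) * c ≤ δ := by
    refine (mul_le_mul_of_nonneg_right (min_le_right _ _) hcpos.le).trans ?_
    rw [div_mul_cancel₀ _ hcpos.ne']
  exact add_le_add_right h1 _

end Counting

/-- For a continuous action of a countably infinite (discrete) amenable group `G` on a
compact Hausdorff space `X` and any tempered Følner sequence `{F n}` in `G`, the Bowen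
dimensional entropy of the whole space is bounded below by the topological entropy:
`h^B_top(X,{F n}) ≥ h_top(X,G)`. -/
theorem bowenEntropy_univ_ge_topEntropy
    {G : Type*} [Group G] [DecidableEq G] [Countable G] [Infinite G]
    (X : Type*) [TopologicalSpace X] [CompactSpace X] [T2Space X]
    [MulAction G X] [ContinuousConstSMul G X]
    (Fseq : ℕ → Finset G) (hFol : IsFolnerSeq Fseq) (hTemp : IsTemperedSeq Fseq) :
    topEntropy X Fseq ≤ bowenEntropy Fseq (Set.univ : Set X) := by
  exact iSup₂_mono fun _ h𝒰 => le_iInf₂ fun _ hs =>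
    coverEntropyOf_le_of_bowenMlim_eq_zero hFol hTemp h𝒰 hs
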